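/- For a subset S of indices (with suitable invertibility), the group intercentrality d_S(G,θ) := 1ᵀ(I - δG)^{-1}θ - 1ᵀ(I - δG_{S^C S^C})^{-1}θ_{S^C} satisfies the closed form d_S(G,θ) = b_S(G,1)ᵀ (M_{SS}(G))^{-1} b_S(G,θ). -/

import Mathlib

open Matrix

/-- The block of a matrix with rows in `S` and columns in `T`. -/
def blk {n : ℕ} (A : Matrix (Fin n) (Fin n) ℝ) (S T : Finset (Fin n)) :
    Matrix {x // x ∈ S} {x // x ∈ T} ℝ :=
  A.submatrix Subtype.val Subtype.val

/-- Restriction of a vector to the coordinates in `S`. -/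
def restr {n : ℕ} (v : Fin n → ℝ) (S : Finset (Fin n)) : {x // x ∈ S} → ℝ :=
  fun i => v i.val

theorem sum_supp {n : ℕ} (T : Finset (Fin n)) (g : Fin n → ℝ) (hg : ∀ i, i ∉ T → g i = 0) :
    ∑ i, g i = ∑ i : {x // x ∈ T}, g i.val := by
  rw [Finset.sum_coe_sort T g]
  exact (Finset.sum_subset (Finset.subset_univ T) (fun i _ hi => hg i hi)).symm

theorem blk_mulVec {n : ℕ} (A : Matrix (Fin n) (Fin n) ℝ) (R T : Finset (Fin n)) (v : Fin n → ℝ)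
    (hv : ∀ i, i ∉ T → v i = 0) : blk A R T *ᵥ restr v T = restr (A *ᵥ v) R := by
  funext i
  simp only [restr, mulVec, dotProduct, blk, submatrix_apply]
  exact (sum_supp T (fun j => A i.val j * v j) (fun j hj => by simp [hv j hj])).symm

theorem group_intercentrality_closed_form {n : ℕ} (G : Matrix (Fin n) (Fin n) ℝ) (δ : ℝ)
    (θ : Fin n → ℝ) (S : Finset (Fin n)) (hsym : G.IsSymm)
    (h1 : IsUnit (1 - δ • G)) (h2 : IsUnit (1 - δ • blk G Sᶜ Sᶜ))
    (h3 : IsUnit (blk ((1 - δ • G)⁻¹) S S)) :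
    ((∑ i, ((1 - δ • G)⁻¹ *ᵥ θ) i)
        - ∑ i, ((1 - δ • blk G Sᶜ Sᶜ)⁻¹ *ᵥ restr θ Sᶜ) i)
      = restr ((1 - δ • G)⁻¹ *ᵥ fun _ => 1) S ⬝ᵥ
          ((blk ((1 - δ • G)⁻¹) S S)⁻¹ *ᵥ restr ((1 - δ • G)⁻¹ *ᵥ θ) S) := by
  set A := 1 - δ • G with hA
  have hAd : IsUnit A.det := (Matrix.isUnit_iff_isUnit_det _).1 h1
  have hB : 1 - δ • blk G Sᶜ Sᶜ = blk A Sᶜ Sᶜ := by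
    ext i j
    simp only [hA, blk, Matrix.one_apply, Subtype.ext_iff, Matrix.sub_apply, Matrix.smul_apply, submatrix_apply]
  rw [hB] at h2 ⊢
  have hBd := (Matrix.isUnit_iff_isUnit_det _).1 h2
  have hMd := (Matrix.isUnit_iff_isUnit_det _).1 h3
  have hAs : Aᵀ = A := by
    rw [hA, transpose_sub, transpose_smul, hsym.eq, transpose_one]
  have hMs : (A⁻¹)ᵀ = A⁻¹ := by rw [transpose_nonsing_inv, hAs]
  set w := (blk A⁻¹ S S)⁻¹ *ᵥ restr (A⁻¹ *ᵥ θ) S with hw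
  obtain ⟨W, hW, hW0⟩ : ∃ W : Fin n → ℝ, restr W S = w ∧ ∀ i, i ∉ S → W i = 0 := by
    refine ⟨fun i => if h : i ∈ S then w ⟨i, h⟩ else 0, ?_, ?_⟩
    · funext i
      simp [restr]
    · intro i hi
      simp [hi]
  obtain ⟨y, hy⟩ : ∃ y, y = A⁻¹ *ᵥ θ - A⁻¹ *ᵥ W := ⟨_, rfl⟩
  have hMW : restr (A⁻¹ *ᵥ W) S = restr (A⁻¹ *ᵥ θ) S := by
    rw [← blk_mulVec A⁻¹ S S W hW0, hW, hw, mulVec_mulVec, mul_nonsing_inv _ hMd, one_mulVec]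
  have hy0 : ∀ i, i ∉ Sᶜ → y i = 0 := by
    intro i hi
    have hi' : i ∈ S := by simpa using hi
    have h := congrFun hMW ⟨i, hi'⟩
    simp only [restr] at h
    simp [hy, h]
  have hAy : A *ᵥ y = θ - W := by
    rw [hy, mulVec_sub, mulVec_mulVec, mulVec_mulVec, mul_nonsing_inv _ hAd, one_mulVec, one_mulVec]
  have hr : restr θ Sᶜ = blk A Sᶜ Sᶜ *ᵥ restr y Sᶜ := by
    rw [blk_mulVec A Sᶜ Sᶜ y hy0, hAy]
    funext i
    have := hW0 i.val (Finset.mem_compl.1 i.2)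
    simp [restr, this]
  rw [hr, mulVec_mulVec, nonsing_inv_mul _ hBd, one_mulVec]
  have hs : ∑ i, restr y Sᶜ i = ∑ i, y i := (sum_supp Sᶜ y hy0).symm
  have hd : restr (A⁻¹ *ᵥ fun _ => 1) S ⬝ᵥ w = (A⁻¹ *ᵥ fun _ => 1) ⬝ᵥ W := by
    rw [← hW]
    exact (sum_supp S (fun i => (A⁻¹ *ᵥ fun _ => 1) i * W i)
      (fun i hi => by simp [hW0 i hi])).symm
  have he : (A⁻¹ *ᵥ fun _ => 1) ⬝ᵥ W = ∑ i, (A⁻¹ *ᵥ W) i := by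
    rw [← hMs, mulVec_transpose, ← dotProduct_mulVec, hMs]
    simp [dotProduct]
  rw [hs, hd, he, hy]
  simp [Finset.sum_sub_distrib]
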